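/- arXiv:2405.16987 — 2 statements merged into one kernel-verified Lean document; each statement's English description precedes it below -/
import Mathlib

section
/- Let n be a positive integer with 3 ∤ (n+1). Then the map t ↦ (t³, t^{n+1}) is a bijection from the set {t ∈ ℂ\{0} : t^{2n+2} + 3t^{n+4} = 1} onto the set of solutions (x, y) ∈ (ℂ\{0})² of the system of equations 1 − y³/x^{n+1} = 0 and 1 + 3y²/xⁿ − 1/y² = 0. -/
theorem pow_left_injective_of_coprime {G : Type*} [CommGroupWithZero G] {m n : ℕ}
    (h : m.Coprime n) {a b : G} (hb : b ≠ 0) (hm : a ^ m = b ^ m) (hn : a ^ n = b ^ n) :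
    a = b := by
  have h1 : (a / b) ^ m = 1 := by rw [div_pow, hm, div_self (pow_ne_zero _ hb)]
  have h2 : (a / b) ^ n = 1 := by rw [div_pow, hn, div_self (pow_ne_zero _ hb)]
  have h3 : orderOf (a / b) ∣ 1 :=
    h ▸ Nat.dvd_gcd (orderOf_dvd_of_pow_eq_one h1) (orderOf_dvd_of_pow_eq_one h2)
  exact (div_eq_one_iff_eq hb).mp (orderOf_eq_one_iff.mp (Nat.dvd_one.mp h3))

theorem reduced_critical_equation_iff {K : Type*} [Field K] (n : ℕ) {t : K} (ht : t ≠ 0) :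
    1 + 3 * (t ^ (n + 1)) ^ 2 / (t ^ 3) ^ n - 1 / (t ^ (n + 1)) ^ 2 = 0 ↔
      t ^ (2 * n + 2) + 3 * t ^ (n + 4) = 1 := by
  have h : 1 + 3 * (t ^ (n + 1)) ^ 2 / (t ^ 3) ^ n - 1 / (t ^ (n + 1)) ^ 2 =
      (t ^ (2 * n + 2) + 3 * t ^ (n + 4) - 1) / t ^ (2 * n + 2) := by
    have h1 : (t ^ (n + 1)) ^ 2 = t ^ (2 * n + 2) := by ring
    have h2 : t ^ (2 * n + 2) / (t ^ 3) ^ n = t ^ (n + 4) / t ^ (2 * n + 2) := by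
      rw [div_eq_div_iff (pow_ne_zero _ (pow_ne_zero _ ht)) (pow_ne_zero _ ht)]
      ring
    rw [h1, mul_div_assoc, h2, sub_div, add_div, div_self (pow_ne_zero _ ht), mul_div_assoc]
  rw [h, div_eq_zero_iff, or_iff_left (pow_ne_zero _ ht), sub_eq_zero]

theorem stmt_2 (n : ℕ) (hn : 0 < n) (h3 : ¬ (3 ∣ (n + 1))) :
    Set.BijOn (fun t : ℂ => (t ^ 3, t ^ (n + 1)))
      {t : ℂ | t ≠ 0 ∧ t ^ (2 * n + 2) + 3 * t ^ (n + 4) = 1}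
      {p : ℂ × ℂ | p.1 ≠ 0 ∧ p.2 ≠ 0 ∧
        1 - p.2 ^ 3 / p.1 ^ (n + 1) = 0 ∧
        1 + 3 * p.2 ^ 2 / p.1 ^ n - 1 / p.2 ^ 2 = 0} := by
  have hcop : Nat.Coprime 3 (n + 1) := (Nat.Prime.coprime_iff_not_dvd Nat.prime_three).mpr h3
  refine ⟨?_, ?_, ?_⟩
  · rintro t ⟨ht, h⟩
    refine ⟨pow_ne_zero _ ht, pow_ne_zero _ ht, ?_, (reduced_critical_equation_iff n ht).mpr h⟩
    rw [pow_right_comm, div_self (pow_ne_zero _ (pow_ne_zero _ ht)), sub_self]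
  · rintro a _ b ⟨hb, _⟩ h
    exact pow_left_injective_of_coprime hcop hb (congrArg Prod.fst h) (congrArg Prod.snd h)
  · rintro ⟨x, y⟩ ⟨hx, hy, h1, h2⟩
    have hyx : y ^ 3 = x ^ (n + 1) :=
      ((div_eq_one_iff_eq (pow_ne_zero _ hx)).mp (sub_eq_zero.mp h1).symm)
    obtain ⟨t, rfl, rfl⟩ := (pow_eq_pow_iff_of_coprime hcop).mp hyx
    have ht : t ≠ 0 := ne_zero_pow three_ne_zero hx
    exact ⟨t, ⟨ht, (reduced_critical_equation_iff n ht).mp h2⟩, rfl⟩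
end

section
/- Let r be a real number with 0 < r < 1/2 and let n > 10 be an integer. Define θ(s) = (9 − 6s + r²)³ · ((n−2)² + (4n−8)s + 4r²)^{n−2} for real s. Then θ′(s) > 0 for all s ∈ [−r, r]; in particular θ is strictly increasing on [−r, r]. -/
theorem stmt_13 (r : ℝ) (hr0 : 0 < r) (hr : r < 1 / 2) (n : ℕ) (hn : 10 < n)
    (θ : ℝ → ℝ)
    (hθ : ∀ s : ℝ, θ s = (9 - 6 * s + r ^ 2) ^ 3 *
      (((n : ℝ) - 2) ^ 2 + (4 * (n : ℝ) - 8) * s + 4 * r ^ 2) ^ (n - 2)) :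
    (∀ s ∈ Set.Icc (-r) r, 0 < deriv θ s) ∧ StrictMonoOn θ (Set.Icc (-r) r) := by
  obtain ⟨k, rfl⟩ : ∃ k, n = k + 3 := ⟨n - 3, by omega⟩
  have hk : (8 : ℝ) ≤ k := by exact_mod_cast (by omega : 8 ≤ k)
  obtain ⟨m, hm⟩ : ∃ m : ℝ, m = k + 1 := ⟨_, rfl⟩
  have hm9 : 9 ≤ m := by linarith
  have hθ_eq : θ = fun s ↦ (9 - 6 * s + r ^ 2) ^ 3 *
      (m ^ 2 + 4 * m * s + 4 * r ^ 2) ^ (k + 1) := by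
    funext s
    rw [hθ, hm, show k + 3 - 2 = k + 1 by omega]
    push_cast
    ring
  have hderiv (s : ℝ) : HasDerivAt θ ((9 - 6 * s + r ^ 2) ^ 2 *
      (m ^ 2 + 4 * m * s + 4 * r ^ 2) ^ k *
      (4 * m ^ 2 * (9 - 6 * s + r ^ 2) - 18 * (m ^ 2 + 4 * m * s + 4 * r ^ 2))) s := by
    have hA : HasDerivAt (fun s : ℝ ↦ 9 - 6 * s + r ^ 2) (-6) s := by
      simpa using (((hasDerivAt_id s).const_mul 6).const_sub 9).add_const (r ^ 2)
    have hB : HasDerivAt (fun s : ℝ ↦ m ^ 2 + 4 * m * s + 4 * r ^ 2) (4 * m) s := by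
      simpa using (((hasDerivAt_id s).const_mul (4 * m)).const_add (m ^ 2)).add_const (4 * r ^ 2)
    rw [hθ_eq]
    refine ((hA.fun_pow 3).fun_mul (hB.fun_pow (k + 1))).congr_deriv ?_
    rw [Nat.add_sub_cancel]
    push_cast
    rw [← hm]
    ring
  have hpos (s : ℝ) (hs : s ∈ Set.Icc (-r) r) : 0 < deriv θ s := by
    rw [(hderiv s).deriv]
    obtain ⟨hs₁, hs₂⟩ := hs
    have hA : 0 < 9 - 6 * s + r ^ 2 := by nlinarith
    have hB : 0 < m ^ 2 + 4 * m * s + 4 * r ^ 2 := by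
      have : 0 < (m - 2 * r) ^ 2 := pow_pos (by linarith) 2
      nlinarith [mul_nonneg (by linarith : 0 ≤ m) (by linarith : 0 ≤ s + r)]
    have hC : 0 < 4 * m ^ 2 * (9 - 6 * s + r ^ 2) -
        18 * (m ^ 2 + 4 * m * s + 4 * r ^ 2) := by
      have h₁ : 0 ≤ m ^ 2 * (1 / 2 - s) := mul_nonneg (by positivity) (by linarith)
      have h₂ : 0 ≤ m * (1 / 2 - s) := mul_nonneg (by linarith) (by linarith)
      have h₃ : r ^ 2 ≤ 1 / 4 := by nlinarith
      have h₄ : 0 ≤ m ^ 2 * r ^ 2 := by positivity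
      nlinarith
    positivity
  refine ⟨hpos, strictMonoOn_of_deriv_pos (convex_Icc _ _)
    (fun s _ ↦ (hderiv s).continuousAt.continuousWithinAt) fun s hs ↦ hpos s (interior_subset hs)⟩
end
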